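/- Let N ≥ 2, let m_1,…,m_N > 0, and let q = (q_1,…,q_N) be a candidate solution of the curved N-body problem in H³ of negative hyperbolic form, with q_ij(t)² ≠ 1 for i ≠ j. Then q solves the equations of motion in H³ if and only if there exists a constant c such that β̇ = c/(Σ_{j=1}^N m_j ρ_j²), where ρ_j := (w_j² + x_j² + 1)^{1/2}, and for every i = 1,…,N and every t: (1) ẅ_i = Σ_{j≠i} m_j (w_j + q_ij w_i)/(q_ij² − 1)^{3/2} + K_i w_i; (2) ẍ_i = Σ_{j≠i} m_j (x_j + q_ij x_i)/(q_ij² − 1)^{3/2} + K_i x_i; (3) ρ_i β̈ + 2 ρ̇_i β̇ = Σ_{j≠i} m_j ρ_j sinh(b_j − b_i)/(q_ij² − 1)^{3/2}; where K_i := [(w_i ẋ_i − x_i ẇ_i)² + ẇ_i² + ẋ_i²]/(w_i² + x_i² + 1) + c² (w_i² + x_i² + 1)/[Σ_{j=1}^N m_j (w_j² + x_j² + 1)]². -/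

import Mathlib

open Real Finset

lemma hasDerivAt_of_contDiff_two {f : ℝ → ℝ} (hf : ContDiff ℝ 2 f) (t : ℝ) :
    HasDerivAt f (deriv f t) t :=
  (hf.differentiable (by norm_num)).differentiableAt.hasDerivAt

lemma hasDerivAt_deriv_of_contDiff_two {f : ℝ → ℝ} (hf : ContDiff ℝ 2 f) (t : ℝ) :
    HasDerivAt (deriv f) (deriv (deriv f) t) t := by
  have h : ContDiff ℝ 1 (deriv f) := by
    have hf' : ContDiff ℝ (1 + 1) f := by
      rw [one_add_one_eq_two]
      exact hf
    exact (contDiff_succ_iff_deriv.mp hf').2.2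
  exact (h.differentiable (by norm_num)).differentiableAt.hasDerivAt

lemma deriv_mul_sinh {r β : ℝ → ℝ} (hr : ContDiff ℝ 2 r) (hβ : ContDiff ℝ 2 β) (a t : ℝ) :
    deriv (fun s => r s * Real.sinh (β s + a)) t =
      deriv r t * Real.sinh (β t + a) + r t * deriv β t * Real.cosh (β t + a) := by
  have h := (hasDerivAt_of_contDiff_two hr t).mul
    (((hasDerivAt_of_contDiff_two hβ t).add_const a).sinh)
  refine (h.congr_deriv ?_).deriv
  ring

lemma deriv_mul_cosh {r β : ℝ → ℝ} (hr : ContDiff ℝ 2 r) (hβ : ContDiff ℝ 2 β) (a t : ℝ) :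
    deriv (fun s => r s * Real.cosh (β s + a)) t =
      deriv r t * Real.cosh (β t + a) + r t * deriv β t * Real.sinh (β t + a) := by
  have h := (hasDerivAt_of_contDiff_two hr t).mul
    (((hasDerivAt_of_contDiff_two hβ t).add_const a).cosh)
  refine (h.congr_deriv ?_).deriv
  ring

lemma deriv_deriv_mul_sinh {r β : ℝ → ℝ} (hr : ContDiff ℝ 2 r) (hβ : ContDiff ℝ 2 β)
    (a t : ℝ) :
    deriv (deriv (fun s => r s * Real.sinh (β s + a))) t =
      (deriv (deriv r) t + r t * deriv β t ^ 2) * Real.sinh (β t + a)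
        + (r t * deriv (deriv β) t + 2 * deriv r t * deriv β t) * Real.cosh (β t + a) := by
  rw [funext (deriv_mul_sinh hr hβ a)]
  have hθ := (hasDerivAt_of_contDiff_two hβ t).add_const a
  have h := ((hasDerivAt_deriv_of_contDiff_two hr t).mul hθ.sinh).add
    (((hasDerivAt_of_contDiff_two hr t).mul
      (hasDerivAt_deriv_of_contDiff_two hβ t)).mul hθ.cosh)
  refine (h.congr_deriv ?_).deriv
  simp only [Pi.mul_apply]
  ring

lemma deriv_deriv_mul_cosh {r β : ℝ → ℝ} (hr : ContDiff ℝ 2 r) (hβ : ContDiff ℝ 2 β)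
    (a t : ℝ) :
    deriv (deriv (fun s => r s * Real.cosh (β s + a))) t =
      (deriv (deriv r) t + r t * deriv β t ^ 2) * Real.cosh (β t + a)
        + (r t * deriv (deriv β) t + 2 * deriv r t * deriv β t) * Real.sinh (β t + a) := by
  rw [funext (deriv_mul_cosh hr hβ a)]
  have hθ := (hasDerivAt_of_contDiff_two hβ t).add_const a
  have h := ((hasDerivAt_deriv_of_contDiff_two hr t).mul hθ.cosh).add
    (((hasDerivAt_of_contDiff_two hr t).mul
      (hasDerivAt_deriv_of_contDiff_two hβ t)).mul hθ.sinh)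
  refine (h.congr_deriv ?_).deriv
  simp only [Pi.mul_apply]
  ring

lemma sum_sum_erase_eq_zero_of_antisymm {ι : Type*} [Fintype ι] [DecidableEq ι]
    (F : ι → ι → ℝ) (hF : ∀ i j, F j i = -F i j) :
    ∑ i, ∑ j ∈ Finset.univ.erase i, F i j = 0 := by
  have hdiag : ∀ i, F i i = 0 := fun i => by linarith [hF i i]
  have herase : ∀ i, ∑ j ∈ Finset.univ.erase i, F i j = ∑ j, F i j := fun i =>
    Finset.sum_erase _ (hdiag i)
  simp only [herase]
  have hswap : ∑ i, ∑ j, F i j = -∑ i, ∑ j, F i j := by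
    conv_lhs => rw [Finset.sum_comm]
    simp only [← Finset.sum_neg_distrib]
    exact Finset.sum_congr rfl fun i _ => Finset.sum_congr rfl fun j _ => hF i j
  linarith

/-- Criterion for negative hyperbolic rotopulsators in H³. -/
theorem negative_hyperbolic_criterion
    (N : ℕ) (hN : 2 ≤ N)
    (m b : Fin N → ℝ) (hm : ∀ i, 0 < m i)
    (β : ℝ → ℝ) (w x ρ Y Z : Fin N → ℝ → ℝ)
    (hβC : ContDiff ℝ 2 β)
    (hwC : ∀ i, ContDiff ℝ 2 (w i))
    (hxC : ∀ i, ContDiff ℝ 2 (x i))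
    (hρ : ∀ i t, ρ i t = Real.sqrt (w i t ^ 2 + x i t ^ 2 + 1))
    (hY : ∀ i t, Y i t = ρ i t * Real.sinh (β t + b i))
    (hZ : ∀ i t, Z i t = ρ i t * Real.cosh (β t + b i))
    (q : Fin N → Fin N → ℝ → ℝ)
    (hq : ∀ i j t, q i j t =
      w i t * w j t + x i t * x j t + Y i t * Y j t - Z i t * Z j t)
    (hreg : ∀ i j, i ≠ j → ∀ t, q i j t ^ 2 ≠ 1) :
    (∀ f : Fin N → ℝ → ℝ, (f = w ∨ f = x ∨ f = Y ∨ f = Z) → ∀ i t,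
        deriv (deriv (f i)) t =
          (∑ j ∈ Finset.univ.erase i,
            m j * (f j t + q i j t * f i t) / (q i j t ^ 2 - 1) ^ ((3:ℝ)/2))
          + (deriv (w i) t ^ 2 + deriv (x i) t ^ 2 + deriv (Y i) t ^ 2
              - deriv (Z i) t ^ 2) * f i t)
    ↔
    (∃ c : ℝ,
      (∀ t, deriv β t = c / ∑ j, m j * ρ j t ^ 2) ∧
      (∀ i t,
        deriv (deriv (w i)) t =
          (∑ j ∈ Finset.univ.erase i,
            m j * (w j t + q i j t * w i t) / (q i j t ^ 2 - 1) ^ ((3:ℝ)/2))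
          + (((w i t * deriv (x i) t - x i t * deriv (w i) t) ^ 2
                + deriv (w i) t ^ 2 + deriv (x i) t ^ 2)
              / (w i t ^ 2 + x i t ^ 2 + 1)
             + c ^ 2 * (w i t ^ 2 + x i t ^ 2 + 1)
              / (∑ j, m j * (w j t ^ 2 + x j t ^ 2 + 1)) ^ 2) * w i t) ∧
      (∀ i t,
        deriv (deriv (x i)) t =
          (∑ j ∈ Finset.univ.erase i,
            m j * (x j t + q i j t * x i t) / (q i j t ^ 2 - 1) ^ ((3:ℝ)/2))
          + (((w i t * deriv (x i) t - x i t * deriv (w i) t) ^ 2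
                + deriv (w i) t ^ 2 + deriv (x i) t ^ 2)
              / (w i t ^ 2 + x i t ^ 2 + 1)
             + c ^ 2 * (w i t ^ 2 + x i t ^ 2 + 1)
              / (∑ j, m j * (w j t ^ 2 + x j t ^ 2 + 1)) ^ 2) * x i t) ∧
      (∀ i t,
        ρ i t * deriv (deriv β) t + 2 * deriv (ρ i) t * deriv β t =
          ∑ j ∈ Finset.univ.erase i,
            m j * ρ j t * Real.sinh (b j - b i)
              / (q i j t ^ 2 - 1) ^ ((3:ℝ)/2))) := by
  have hsq : ∀ i t, ρ i t ^ 2 = w i t ^ 2 + x i t ^ 2 + 1 := fun i t => by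
    rw [hρ, Real.sq_sqrt (by positivity)]
  have hpos : ∀ i t, 0 < ρ i t := fun i t => by
    rw [hρ]
    positivity
  have hρC : ∀ i, ContDiff ℝ 2 (ρ i) := fun i => by
    rw [funext (hρ i)]
    exact ((((hwC i).pow 2).add ((hxC i).pow 2)).add contDiff_const).sqrt
      fun t => by positivity
  have hYf : ∀ i, Y i = fun s => ρ i s * Real.sinh (β s + b i) := fun i => funext (hY i)
  have hZf : ∀ i, Z i = fun s => ρ i s * Real.cosh (β s + b i) := fun i => funext (hZ i)
  have hM : ∀ t, 0 < ∑ j, m j * ρ j t ^ 2 := fun t =>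
    Finset.sum_pos (fun j _ => mul_pos (hm j) (pow_pos (hpos j t) 2))
      ⟨⟨0, by omega⟩, Finset.mem_univ _⟩
  have hqρ : ∀ i j t, q i j t =
      w i t * w j t + x i t * x j t - ρ i t * ρ j t * Real.cosh (b j - b i) := by
    intro i j t
    have e : b j - b i = (β t + b j) - (β t + b i) := by ring
    rw [hq, hY, hY, hZ, hZ, e, Real.cosh_sub]
    ring
  have hqsymm : ∀ i j t, q j i t = q i j t := fun i j t => by
    rw [hq, hq]
    ring
  -- first and second derivatives of `ρ² = w² + x² + 1`
  have hd1 : ∀ i t, ρ i t * deriv (ρ i) t = w i t * deriv (w i) t + x i t * deriv (x i) t := by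
    intro i t
    have h1 := (hasDerivAt_of_contDiff_two (hρC i) t).pow 2
    have h2 := (((hasDerivAt_of_contDiff_two (hwC i) t).pow 2).add
      ((hasDerivAt_of_contDiff_two (hxC i) t).pow 2)).add_const 1
    have h3 := h1.unique (h2.congr_of_eventuallyEq (Filter.Eventually.of_forall (hsq i)))
    norm_num at h3
    linarith
  have hd2 : ∀ i t, deriv (ρ i) t ^ 2 + ρ i t * deriv (deriv (ρ i)) t =
      deriv (w i) t ^ 2 + w i t * deriv (deriv (w i)) t
        + (deriv (x i) t ^ 2 + x i t * deriv (deriv (x i)) t) := by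
    intro i t
    have h1 := (hasDerivAt_of_contDiff_two (hρC i) t).mul
      (hasDerivAt_deriv_of_contDiff_two (hρC i) t)
    have h2 := ((hasDerivAt_of_contDiff_two (hwC i) t).mul
      (hasDerivAt_deriv_of_contDiff_two (hwC i) t)).add
      ((hasDerivAt_of_contDiff_two (hxC i) t).mul
        (hasDerivAt_deriv_of_contDiff_two (hxC i) t))
    have h3 := h1.unique (h2.congr_of_eventuallyEq (Filter.Eventually.of_forall (hd1 i)))
    linarith
  have hS : ∀ i t, deriv (w i) t ^ 2 + deriv (x i) t ^ 2 + deriv (Y i) t ^ 2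
      - deriv (Z i) t ^ 2 =
      deriv (w i) t ^ 2 + deriv (x i) t ^ 2 - deriv (ρ i) t ^ 2
        + ρ i t ^ 2 * deriv β t ^ 2 := by
    intro i t
    rw [hYf, hZf, deriv_mul_sinh (hρC i) hβC, deriv_mul_cosh (hρC i) hβC]
    linear_combination (ρ i t ^ 2 * deriv β t ^ 2 - deriv (ρ i) t ^ 2)
      * Real.cosh_sq (β t + b i)
  have hK : ∀ c : ℝ, (∀ t, deriv β t = c / ∑ j, m j * ρ j t ^ 2) → ∀ i t,
      ((w i t * deriv (x i) t - x i t * deriv (w i) t) ^ 2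
          + deriv (w i) t ^ 2 + deriv (x i) t ^ 2) / (w i t ^ 2 + x i t ^ 2 + 1)
        + c ^ 2 * (w i t ^ 2 + x i t ^ 2 + 1)
          / (∑ j, m j * (w j t ^ 2 + x j t ^ 2 + 1)) ^ 2 =
      deriv (w i) t ^ 2 + deriv (x i) t ^ 2 + deriv (Y i) t ^ 2 - deriv (Z i) t ^ 2 := by
    intro c hc i t
    have h1 : ((w i t * deriv (x i) t - x i t * deriv (w i) t) ^ 2
          + deriv (w i) t ^ 2 + deriv (x i) t ^ 2) / (w i t ^ 2 + x i t ^ 2 + 1) =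
        deriv (w i) t ^ 2 + deriv (x i) t ^ 2 - deriv (ρ i) t ^ 2 := by
      rw [div_eq_iff (by positivity)]
      linear_combination (-deriv (ρ i) t ^ 2) * hsq i t
        + (ρ i t * deriv (ρ i) t + (w i t * deriv (w i) t + x i t * deriv (x i) t)) * hd1 i t
    rw [hS, h1, hc t]
    simp only [← hsq]
    ring
  have hsinh : ∀ i t,
      Real.cosh (β t + b i) * (∑ j ∈ Finset.univ.erase i,
        m j * (Y j t + q i j t * Y i t) / (q i j t ^ 2 - 1) ^ ((3:ℝ)/2))
      - Real.sinh (β t + b i) * (∑ j ∈ Finset.univ.erase i,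
        m j * (Z j t + q i j t * Z i t) / (q i j t ^ 2 - 1) ^ ((3:ℝ)/2)) =
      ∑ j ∈ Finset.univ.erase i,
        m j * ρ j t * Real.sinh (b j - b i) / (q i j t ^ 2 - 1) ^ ((3:ℝ)/2) := by
    intro i t
    rw [Finset.mul_sum, Finset.mul_sum, ← Finset.sum_sub_distrib]
    refine Finset.sum_congr rfl fun j _ => ?_
    have e : b j - b i = (β t + b j) - (β t + b i) := by ring
    rw [e, Real.sinh_sub, hY, hY, hZ, hZ]
    generalize (q i j t ^ 2 - 1) ^ ((3:ℝ)/2) = D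
    ring
  have hcosh : ∀ i t,
      ρ i t * (Real.cosh (β t + b i) * (∑ j ∈ Finset.univ.erase i,
        m j * (Z j t + q i j t * Z i t) / (q i j t ^ 2 - 1) ^ ((3:ℝ)/2))
      - Real.sinh (β t + b i) * (∑ j ∈ Finset.univ.erase i,
        m j * (Y j t + q i j t * Y i t) / (q i j t ^ 2 - 1) ^ ((3:ℝ)/2))) =
      w i t * (∑ j ∈ Finset.univ.erase i,
        m j * (w j t + q i j t * w i t) / (q i j t ^ 2 - 1) ^ ((3:ℝ)/2))
      + x i t * (∑ j ∈ Finset.univ.erase i,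
        m j * (x j t + q i j t * x i t) / (q i j t ^ 2 - 1) ^ ((3:ℝ)/2)) := by
    intro i t
    simp only [Finset.mul_sum]
    rw [← Finset.sum_sub_distrib, Finset.mul_sum, ← Finset.sum_add_distrib]
    refine Finset.sum_congr rfl fun j _ => ?_
    generalize (q i j t ^ 2 - 1) ^ ((3:ℝ)/2) = D
    have e : b j - b i = (β t + b j) - (β t + b i) := by ring
    have hqc := hqρ i j t
    rw [e, Real.cosh_sub] at hqc
    rw [hY, hY, hZ, hZ]
    linear_combination m j / D * (q i j t * ρ i t ^ 2 * Real.cosh_sq (β t + b i)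
      + q i j t * hsq i t + hqc)
  constructor
  · intro H
    have H3 : ∀ i t, ρ i t * deriv (deriv β) t + 2 * deriv (ρ i) t * deriv β t =
        ∑ j ∈ Finset.univ.erase i,
          m j * ρ j t * Real.sinh (b j - b i) / (q i j t ^ 2 - 1) ^ ((3:ℝ)/2) := by
      intro i t
      have h1 := H Y (by simp) i t
      have h2 := H Z (by simp) i t
      have h1' := congrArg (fun f => deriv (deriv f) t) (hYf i)
      have h2' := congrArg (fun f => deriv (deriv f) t) (hZf i)
      simp only [deriv_deriv_mul_sinh (hρC i) hβC] at h1'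
      simp only [deriv_deriv_mul_cosh (hρC i) hβC] at h2'
      rw [h1'] at h1
      rw [h2'] at h2
      rw [← hsinh]
      generalize deriv (w i) t ^ 2 + deriv (x i) t ^ 2 + deriv (Y i) t ^ 2
        - deriv (Z i) t ^ 2 = S at h1 h2
      linear_combination Real.cosh (β t + b i) * h1 - Real.sinh (β t + b i) * h2
        - (ρ i t * deriv (deriv β) t + 2 * deriv (ρ i) t * deriv β t)
          * Real.cosh_sq (β t + b i)
        + S * Real.cosh (β t + b i) * hY i t - S * Real.sinh (β t + b i) * hZ i t
    have hder : ∀ t, HasDerivAt (fun s => ∑ j, m j * (ρ j s ^ 2 * deriv β s)) 0 t := by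
      intro t
      have h : HasDerivAt (fun s => ∑ j, m j * (ρ j s ^ 2 * deriv β s))
          (∑ j, m j * (2 * ρ j t * deriv (ρ j) t * deriv β t
            + ρ j t ^ 2 * deriv (deriv β) t)) t := by
        refine HasDerivAt.fun_sum fun j _ => ?_
        refine ((((hasDerivAt_of_contDiff_two (hρC j) t).pow 2).mul
          (hasDerivAt_deriv_of_contDiff_two hβC t)).const_mul (m j)).congr_deriv ?_
        simp
      refine h.congr_deriv ?_
      rw [← sum_sum_erase_eq_zero_of_antisymm (fun i j => m i * ρ i t * (m j * ρ j t *
        Real.sinh (b j - b i) / (q i j t ^ 2 - 1) ^ ((3:ℝ)/2)))]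
      · refine Finset.sum_congr rfl fun i _ => ?_
        rw [← Finset.mul_sum, ← H3]
        ring
      · intro i j
        rw [hqsymm, ← neg_sub (b j) (b i), Real.sinh_neg]
        generalize (q i j t ^ 2 - 1) ^ ((3:ℝ)/2) = D
        ring
    have hconst : ∀ t, ∑ j, m j * (ρ j t ^ 2 * deriv β t) =
        ∑ j, m j * (ρ j 0 ^ 2 * deriv β 0) := fun t =>
      is_const_of_deriv_eq_zero (fun s => (hder s).differentiableAt)
        (fun s => (hder s).deriv) t 0
    have hc : ∀ t, deriv β t =
        (∑ j, m j * (ρ j 0 ^ 2 * deriv β 0)) / ∑ j, m j * ρ j t ^ 2 := by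
      intro t
      rw [eq_div_iff (hM t).ne', ← hconst t, Finset.mul_sum]
      exact Finset.sum_congr rfl fun j _ => by ring
    refine ⟨_, hc, fun i t => ?_, fun i t => ?_, H3⟩
    · rw [hK _ hc]
      exact H w (by simp) i t
    · rw [hK _ hc]
      exact H x (by simp) i t
  · rintro ⟨c, hc, Hw, Hx, H3⟩
    have hrad : ∀ i t, deriv (deriv (ρ i)) t + ρ i t * deriv β t ^ 2 =
        Real.cosh (β t + b i) * (∑ j ∈ Finset.univ.erase i,
          m j * (Z j t + q i j t * Z i t) / (q i j t ^ 2 - 1) ^ ((3:ℝ)/2))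
        - Real.sinh (β t + b i) * (∑ j ∈ Finset.univ.erase i,
          m j * (Y j t + q i j t * Y i t) / (q i j t ^ 2 - 1) ^ ((3:ℝ)/2))
        + (deriv (w i) t ^ 2 + deriv (x i) t ^ 2 + deriv (Y i) t ^ 2
            - deriv (Z i) t ^ 2) * ρ i t := by
      intro i t
      have h1 := hcosh i t
      have h2 := hS i t
      have h3 := Hw i t
      have h4 := Hx i t
      rw [hK c hc i t] at h3 h4
      refine mul_left_cancel₀ (hpos i t).ne' ?_
      generalize deriv (w i) t ^ 2 + deriv (x i) t ^ 2 + deriv (Y i) t ^ 2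
        - deriv (Z i) t ^ 2 = S at h2 h3 h4 ⊢
      linear_combination hd2 i t + w i t * h3 + x i t * h4 - h1 - h2 - S * hsq i t
    rintro f (rfl | rfl | rfl | rfl) i t
    · rw [Hw, hK c hc]
    · rw [Hx, hK c hc]
    · have h1 := hrad i t
      have h2 := (H3 i t).trans (hsinh i t).symm
      have h3 := congrArg (fun g => deriv (deriv g) t) (hYf i)
      simp only [deriv_deriv_mul_sinh (hρC i) hβC] at h3
      rw [h3, h1, h2]
      generalize deriv (w i) t ^ 2 + deriv (x i) t ^ 2 + deriv (f i) t ^ 2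
        - deriv (Z i) t ^ 2 = S
      generalize (∑ j ∈ Finset.univ.erase i,
        m j * (f j t + q i j t * f i t) / (q i j t ^ 2 - 1) ^ ((3:ℝ)/2)) = A
      linear_combination A * Real.cosh_sq (β t + b i) - S * hY i t
    · have h1 := hrad i t
      have h2 := (H3 i t).trans (hsinh i t).symm
      have h3 := congrArg (fun g => deriv (deriv g) t) (hZf i)
      simp only [deriv_deriv_mul_cosh (hρC i) hβC] at h3
      rw [h3, h1, h2]
      generalize deriv (w i) t ^ 2 + deriv (x i) t ^ 2 + deriv (Y i) t ^ 2
        - deriv (f i) t ^ 2 = S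
      generalize (∑ j ∈ Finset.univ.erase i,
        m j * (f j t + q i j t * f i t) / (q i j t ^ 2 - 1) ^ ((3:ℝ)/2)) = A
      linear_combination A * Real.cosh_sq (β t + b i) - S * hZ i t
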